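/- Low-Mach-number limit for the non-isentropic two-phase two-velocity system with algebraic pressure closure and interfacial pressure (order-by-order form of Proposition 4.2). Let d ≥ 1 and γ₊, γ₋ > 1. Let α₊⁰, α₋⁰, α₊¹, α₋¹, ρ₊⁰, ρ₋⁰, ρ₊¹, ρ₋¹, S₊⁰, S₋⁰, S₊¹, S₋¹, p_int⁰ : ℝ × ℝ^d → ℝ and u₊⁰, u₋⁰ : ℝ × ℝ^d → ℝ^d be smooth ℤ^d-periodic functions with ρ₊⁰ > 0, ρ₋⁰ > 0, 0 < α₊⁰ < 1 everywhere, and set p±⁰ := (ρ±⁰)^{γ±}e^{S±⁰} and π±¹ := p±⁰(γ± ρ±¹/ρ±⁰ + S±¹). Assume: (i) α₊⁰ + α₋⁰ = 1; (ii) p₊⁰ = p₋⁰ and π₊¹ = π₋¹; (iii) α±⁰∇p±⁰ = 0 for both phases; (iv) ∂ₜ(α±⁰ρ±⁰) + div(α±⁰ρ±⁰u±⁰) = 0 for both phases; (v) ∂ₜS±⁰ + u±⁰·∇S±⁰ = 0 for both phases; (vi) for each phase, ∂ₜ(α±⁰ρ±⁰u±⁰) + div(α±⁰ρ±⁰u±⁰⊗u±⁰)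 + α±⁰∇π±¹ + α±¹∇p±⁰ + p_int⁰∇α±⁰ = 0. Then: there is a constant C > 0 (in space and time) with p₊⁰ = p₋⁰ = C, hence ρ±⁰ = C^{1/γ±}e^{−S±⁰/γ±}; div(α₊⁰u₊⁰ + α₋⁰u₋⁰) = 0; ∂ₜα±⁰ + div(α±⁰u±⁰) = 0 for both phases; and, setting π¹ := π₊¹ = π₋¹, the limit momentum equations ∂ₜ(α±⁰ρ±⁰u±⁰) + div(α±⁰ρ±⁰u±⁰⊗u±⁰) + α±⁰∇π¹ + p_int⁰∇α±⁰ = 0 hold for both phases. -/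

import Mathlib

open MeasureTheory Real

noncomputable section

/-- A space–time point: time in `ℝ`, space in `ℝ^d`. -/
abbrev Pt (d : ℕ) := ℝ × (Fin d → ℝ)

/-- Time derivative `∂ₜ f`. -/
def pt {d : ℕ} (f : Pt d → ℝ) (p : Pt d) : ℝ :=
  fderiv ℝ f p (1, 0)

/-- Spatial partial derivative `∂_{x i} f`. -/
def pd {d : ℕ} (i : Fin d) (f : Pt d → ℝ) (p : Pt d) : ℝ :=
  fderiv ℝ f p (0, Pi.single i 1)

/-- Spatial divergence of a vector field. -/
def divg {d : ℕ} (u : Pt d → Fin d → ℝ) (p : Pt d) : ℝ :=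
  ∑ i, pd i (fun q => u q i) p

/-- Spatial Laplacian of a scalar function. -/
def lap {d : ℕ} (f : Pt d → ℝ) (p : Pt d) : ℝ :=
  ∑ i, pd i (fun q => pd i f q) p

/-- `i`-th component of `div (r u ⊗ u)`, i.e. `∑ j ∂_{x j} (r u_i u_j)`. -/
def divT {d : ℕ} (r : Pt d → ℝ) (u : Pt d → Fin d → ℝ) (p : Pt d) (i : Fin d) : ℝ :=
  ∑ j, pd j (fun q => r q * u q i * u q j) p

/-- Symmetric gradient `D(u) = (∇u + (∇u)ᵀ)/2`. -/
def Dsym {d : ℕ} (u : Pt d → Fin d → ℝ) (p : Pt d) (i j : Fin d) : ℝ :=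
  (pd j (fun q => u q i) p + pd i (fun q => u q j) p) / 2

/-- Divergence of a matrix field, `i`-th component `∑ j ∂_{x j} M_{ij}`. -/
def divM {d : ℕ} (M : Pt d → Fin d → Fin d → ℝ) (p : Pt d) (i : Fin d) : ℝ :=
  ∑ j, pd j (fun q => M q i j) p

/-- `ℤ^d`-periodicity in the space variable. -/
def ZPeriodic {d : ℕ} (f : Pt d → ℝ) : Prop :=
  ∀ (k : Fin d → ℤ) (t : ℝ) (x : Fin d → ℝ), f (t, x + fun i => (k i : ℝ)) = f (t, x)

/-- `ℤ^d`-periodicity of a vector field. -/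
def ZPeriodicVec {d : ℕ} (u : Pt d → Fin d → ℝ) : Prop :=
  ∀ i, ZPeriodic (fun q => u q i)

/-- The unit cell `[0,1]^d`. -/
def cell (d : ℕ) : Set (Fin d → ℝ) := Set.Icc 0 1

/-- The divergence theorem on the torus: a smooth periodic spatial vector field has divergence of
mean zero over the unit cell, at every time. -/
lemma setIntegral_divg_eq_zero {n : ℕ} {F : Pt (n + 1) → Fin (n + 1) → ℝ}
    (hF : ∀ i, ContDiff ℝ 1 fun q => F q i) (hper : ZPeriodicVec F) (t : ℝ) :
    ∫ x in cell (n + 1), divg F (t, x) = 0 := by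
  have hd : ∀ i x, HasFDerivAt (fun x : Fin (n + 1) → ℝ => F (t, x) i)
      ((fderiv ℝ (fun q => F q i) (t, x)).comp (ContinuousLinearMap.inr ℝ ℝ (Fin (n + 1) → ℝ)))
      x := fun i x =>
    (((hF i).differentiable one_ne_zero).differentiableAt.hasFDerivAt).comp x
      (hasFDerivAt_prodMk_right t x)
  have hcont : Continuous fun x : Fin (n + 1) → ℝ => divg F (t, x) := by
    unfold divg pd
    refine continuous_finsetSum _ fun i _ => ?_
    exact (((hF i).continuous_fderiv one_ne_zero).comp (by fun_prop)).clm_apply continuous_const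
  have key := integral_divergence_of_hasFDerivAt_off_countable' (0 : Fin (n + 1) → ℝ) 1
    (fun _ => zero_le_one) (fun i x => F (t, x) i) _ ∅ Set.countable_empty
    (fun i x _ => (hd i x).continuousAt.continuousWithinAt) (fun x _ i => hd i x)
    (hcont.continuousOn.integrableOn_compact isCompact_Icc)
  refine key.trans (Finset.sum_eq_zero fun i _ => sub_eq_zero.2 ?_)
  refine integral_congr_ae (ae_of_all _ fun x => ?_)
  have h := hper i (Pi.single i 1) t (i.insertNth (0 : ℝ) x)
  have e : (i.insertNth (0 : ℝ) x : Fin (n + 1) → ℝ) +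
      (fun j => ((Pi.single i 1 : Fin (n + 1) → ℤ) j : ℝ)) = i.insertNth (1 : ℝ) x := by
    ext j
    refine Fin.succAboveCases i ?_ (fun k => ?_) j <;> simp
  rw [e] at h
  exact h

/-- If a smooth periodic field has divergence `-c w` with `w > 0` at a fixed time, then `c = 0`. -/
lemma eq_zero_of_divg_eq_neg_mul {n : ℕ} {F : Pt (n + 1) → Fin (n + 1) → ℝ}
    (hF : ∀ i, ContDiff ℝ 1 fun q => F q i) (hper : ZPeriodicVec F) (t c : ℝ)
    {w : (Fin (n + 1) → ℝ) → ℝ} (hw : Continuous w) (hpos : ∀ x, 0 < w x)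
    (h : ∀ x, divg F (t, x) = -c * w x) : c = 0 := by
  have h0 := setIntegral_divg_eq_zero hF hper t
  simp_rw [h] at h0
  rw [integral_const_mul] at h0
  have hint : IntegrableOn w (cell (n + 1)) :=
    hw.continuousOn.integrableOn_compact isCompact_Icc
  have hwpos : 0 < ∫ x in cell (n + 1), w x := by
    rw [setIntegral_pos_iff_support_of_nonneg_ae (ae_of_all _ fun x => (hpos x).le) hint,
      Function.support_eq_univ fun x => (hpos x).ne', Set.univ_inter, cell, Real.volume_Icc_pi]
    simp
  simpa using (mul_eq_zero.1 h0).resolve_right hwpos.ne'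

/-- For a transported entropy and a spatially constant pressure `ρ ^ γ * exp S`, mass conservation
becomes an evolution equation for the volume fraction, forced by the time derivative of the
pressure. -/
lemma pt_add_divg_volumeFraction {d : ℕ} {γ : ℝ} {α ρ S : Pt d → ℝ} {u : Pt d → Fin d → ℝ}
    (hα : Differentiable ℝ α) (hρ : Differentiable ℝ ρ) (hS : Differentiable ℝ S)
    (hu : ∀ i, Differentiable ℝ fun q => u q i) {p : Pt d} (hpos : 0 < ρ p)
    (hgrad : ∀ i, pd i (fun q => ρ q ^ γ * exp (S q)) p = 0)
    (hmass : pt (fun q => α q * ρ q) p + divg (fun q j => α q * ρ q * u q j) p = 0)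
    (hent : pt S p + ∑ i, u p i * pd i S p = 0) :
    γ * (ρ p ^ γ * exp (S p)) * (pt α p + divg (fun q j => α q * u q j) p)
      = -α p * pt (fun q => ρ q ^ γ * exp (S q)) p := by
  have hP : ∀ v, ρ p * fderiv ℝ (fun q => ρ q ^ γ * exp (S q)) p v
      = (ρ p ^ γ * exp (S p)) * (γ * fderiv ℝ ρ p v + ρ p * fderiv ℝ S p v) := fun v => by
    have h := ((hρ p).hasFDerivAt.rpow_const (p := γ) (Or.inl hpos.ne')).mul
      (hS p).hasFDerivAt.exp
    have e : ρ p ^ (γ - 1) * ρ p = ρ p ^ γ := by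
      rw [rpow_sub_one hpos.ne', div_mul_cancel₀ _ hpos.ne']
    rw [show (fun q => ρ q ^ γ * exp (S q)) = (fun q => ρ q ^ γ) * fun q => exp (S q) from rfl,
      h.fderiv]
    simp only [add_apply, smul_apply, smul_eq_mul]
    linear_combination (γ * exp (S p) * fderiv ℝ ρ p v) * e
  have hαρ : ∀ v, fderiv ℝ (fun q => α q * ρ q) p v
      = α p * fderiv ℝ ρ p v + ρ p * fderiv ℝ α p v := fun v => by
    rw [fderiv_fun_mul (hα p) (hρ p)]
    simp
  have hαρu : ∀ i, pd i (fun q => α q * ρ q * u q i) p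
      = ρ p * pd i (fun q => α q * u q i) p + α p * (u p i * pd i ρ p) := fun i => by
    unfold pd
    rw [fderiv_fun_mul ((hα p).fun_mul (hρ p)) (hu i p), fderiv_fun_mul (hα p) (hu i p)]
    simp only [add_apply, smul_apply, smul_eq_mul, hαρ]
    ring
  have hsum : ∑ i, u p i * (γ * pd i ρ p + ρ p * pd i S p) = 0 := by
    refine Finset.sum_eq_zero fun i _ => ?_
    have h := hP (0, Pi.single i 1)
    have hg := hgrad i
    unfold pd at hg ⊢
    rw [hg, mul_zero] at h
    rw [(mul_eq_zero.1 h.symm).resolve_left (by positivity), mul_zero]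
  have hsplit : ∑ i, u p i * (γ * pd i ρ p + ρ p * pd i S p)
      = γ * ∑ i, u p i * pd i ρ p + ρ p * ∑ i, u p i * pd i S p := by
    rw [Finset.mul_sum, Finset.mul_sum, ← Finset.sum_add_distrib]
    exact Finset.sum_congr rfl fun i _ => by ring
  have hPt := hP (1, 0)
  have hm : ρ p * (pt α p + divg (fun q j => α q * u q j) p)
      + α p * (pt ρ p + ∑ i, u p i * pd i ρ p) = 0 := by
    have h := hmass
    unfold divg at h ⊢
    simp_rw [hαρu] at h
    rw [Finset.sum_add_distrib, ← Finset.mul_sum, ← Finset.mul_sum] at h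
    unfold pt at h ⊢
    rw [hαρ] at h
    linear_combination h
  refine mul_left_cancel₀ hpos.ne' ?_
  rw [hsum] at hsplit
  unfold pt at hm hent ⊢
  linear_combination (γ * (ρ p ^ γ * exp (S p))) * hm + α p * hPt
    + α p * (ρ p ^ γ * exp (S p)) * (hsplit + ρ p * hent)

/-- A function whose time derivative and spatial partial derivatives all vanish is constant. -/
lemma eq_of_pt_pd_eq_zero {d : ℕ} {f : Pt d → ℝ} (hf : Differentiable ℝ f)
    (ht : ∀ p, pt f p = 0) (hx : ∀ p i, pd i f p = 0) (p q : Pt d) : f p = f q := by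
  refine is_const_of_fderiv_eq_zero hf (fun r => ?_) p q
  refine ContinuousLinearMap.coe_injective (LinearMap.prod_ext ?_ ?_)
  · ext
    exact ht r
  · refine LinearMap.pi_ext' fun i => ?_
    ext
    exact hx r i

/-- A function whose spatial partial derivatives all vanish depends on time only. -/
lemma eq_of_pd_eq_zero {d : ℕ} {f : Pt d → ℝ} (hf : Differentiable ℝ f)
    (hx : ∀ p i, pd i f p = 0) (t : ℝ) (x y : Fin d → ℝ) : f (t, x) = f (t, y) := by
  have hd : ∀ x, HasFDerivAt (fun x : Fin d → ℝ => f (t, x))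
      ((fderiv ℝ f (t, x)).comp (ContinuousLinearMap.inr ℝ ℝ (Fin d → ℝ))) x := fun x =>
    (hf _).hasFDerivAt.comp x (hasFDerivAt_prodMk_right t x)
  refine is_const_of_fderiv_eq_zero (𝕜 := ℝ) (f := fun x : Fin d → ℝ => f (t, x))
    (fun x => (hd x).differentiableAt) (fun x => ?_) x y
  rw [(hd x).fderiv]
  refine ContinuousLinearMap.coe_injective (LinearMap.pi_ext' fun i => ?_)
  ext
  exact hx _ i

/-- If its spatial partial derivatives vanish, the time derivative depends on time only. -/
lemma pt_eq_of_pd_eq_zero {d : ℕ} {f : Pt d → ℝ} (hf : Differentiable ℝ f)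
    (hx : ∀ p i, pd i f p = 0) (t : ℝ) (x y : Fin d → ℝ) : pt f (t, x) = pt f (t, y) := by
  have hd : ∀ x, HasDerivAt (fun s => f (s, x)) (pt f (t, x)) t := fun x =>
    (hf _).hasFDerivAt.comp_hasDerivAt t ((hasDerivAt_id t).prodMk (hasDerivAt_const t x))
  refine (hd x).unique ?_
  rw [show (fun s => f (s, x)) = fun s => f (s, y) from
    funext fun s => eq_of_pd_eq_zero hf hx s x y]
  exact hd y

/-- Solving the pressure law `ρ ^ γ * exp S = C` for the density. -/
lemma eq_rpow_mul_exp_of_pressure_eq {γ ρ S C : ℝ} (hγ : γ ≠ 0) (hρ : 0 < ρ)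
    (h : ρ ^ γ * exp S = C) : ρ = C ^ (1 / γ) * exp (-S / γ) := by
  rw [← h, mul_rpow (by positivity) (exp_pos _).le, ← rpow_mul hρ.le, ← exp_mul,
    mul_one_div_cancel hγ, rpow_one, mul_assoc, ← exp_add,
    show S * (1 / γ) + -S / γ = 0 by ring, exp_zero, mul_one]

/-- The divergence is additive. -/
lemma divg_add {d : ℕ} {u v : Pt d → Fin d → ℝ} {p : Pt d}
    (hu : ∀ i, DifferentiableAt ℝ (fun q => u q i) p)
    (hv : ∀ i, DifferentiableAt ℝ (fun q => v q i) p) :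
    divg (fun q j => u q j + v q j) p = divg u p + divg v p := by
  unfold divg pd
  rw [← Finset.sum_add_distrib]
  refine Finset.sum_congr rfl fun i _ => ?_
  rw [fderiv_fun_add (hu i) (hv i), add_apply]

/-- low-Mach-number limit for the non-isentropic two-phase two-velocity
system with algebraic pressure closure and interfacial pressure
(order-by-order form of Proposition 4.2). Here `p±⁰ = (ρ±⁰)^{γ±} e^{S±⁰}` and
`π±¹ = p±⁰ (γ± ρ±¹/ρ±⁰ + S±¹)` are written out explicitly. -/
theorem lowMach_twoPhase_twoVelocity_nonisentropic_algebraic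
    {d : ℕ} (hd : 1 ≤ d) (γp γm : ℝ) (hγp : 1 < γp) (hγm : 1 < γm)
    (αp0 αm0 αp1 αm1 ρp0 ρm0 ρp1 ρm1 Sp0 Sm0 Sp1 Sm1 pint0 : Pt d → ℝ)
    (up0 um0 : Pt d → Fin d → ℝ)
    (hreg : ContDiff ℝ (⊤ : ℕ∞) αp0 ∧ ContDiff ℝ (⊤ : ℕ∞) αm0 ∧ ContDiff ℝ (⊤ : ℕ∞) αp1 ∧ ContDiff ℝ (⊤ : ℕ∞) αm1 ∧
      ContDiff ℝ (⊤ : ℕ∞) ρp0 ∧ ContDiff ℝ (⊤ : ℕ∞) ρm0 ∧ ContDiff ℝ (⊤ : ℕ∞) ρp1 ∧ ContDiff ℝ (⊤ : ℕ∞) ρm1 ∧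
      ContDiff ℝ (⊤ : ℕ∞) Sp0 ∧ ContDiff ℝ (⊤ : ℕ∞) Sm0 ∧ ContDiff ℝ (⊤ : ℕ∞) Sp1 ∧ ContDiff ℝ (⊤ : ℕ∞) Sm1 ∧
      ContDiff ℝ (⊤ : ℕ∞) pint0 ∧ ContDiff ℝ (⊤ : ℕ∞) up0 ∧ ContDiff ℝ (⊤ : ℕ∞) um0)
    (hper : ZPeriodic αp0 ∧ ZPeriodic αm0 ∧ ZPeriodic αp1 ∧ ZPeriodic αm1 ∧
      ZPeriodic ρp0 ∧ ZPeriodic ρm0 ∧ ZPeriodic ρp1 ∧ ZPeriodic ρm1 ∧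
      ZPeriodic Sp0 ∧ ZPeriodic Sm0 ∧ ZPeriodic Sp1 ∧ ZPeriodic Sm1 ∧
      ZPeriodic pint0 ∧ ZPeriodicVec up0 ∧ ZPeriodicVec um0)
    (hρp : ∀ p, 0 < ρp0 p) (hρm : ∀ p, 0 < ρm0 p)
    (hαpos : ∀ p, 0 < αp0 p ∧ αp0 p < 1)
    -- (i)
    (hα0 : ∀ p, αp0 p + αm0 p = 1)
    -- (ii)
    (hpeq0 : ∀ p, ρp0 p ^ γp * Real.exp (Sp0 p) = ρm0 p ^ γm * Real.exp (Sm0 p))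
    (hpeq1 : ∀ p,
      ρp0 p ^ γp * Real.exp (Sp0 p) * (γp * ρp1 p / ρp0 p + Sp1 p)
      = ρm0 p ^ γm * Real.exp (Sm0 p) * (γm * ρm1 p / ρm0 p + Sm1 p))
    -- (iii)
    (hgradp : ∀ p (i : Fin d),
      αp0 p * pd i (fun q => ρp0 q ^ γp * Real.exp (Sp0 q)) p = 0)
    (hgradm : ∀ p (i : Fin d),
      αm0 p * pd i (fun q => ρm0 q ^ γm * Real.exp (Sm0 q)) p = 0)
    -- (iv)
    (hmassp : ∀ p, pt (fun q => αp0 q * ρp0 q) p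
      + divg (fun q j => αp0 q * ρp0 q * up0 q j) p = 0)
    (hmassm : ∀ p, pt (fun q => αm0 q * ρm0 q) p
      + divg (fun q j => αm0 q * ρm0 q * um0 q j) p = 0)
    -- (v)
    (hentp : ∀ p : Pt d, pt Sp0 p + ∑ i, up0 p i * pd i Sp0 p = 0)
    (hentm : ∀ p : Pt d, pt Sm0 p + ∑ i, um0 p i * pd i Sm0 p = 0)
    -- (vi)
    (hmomp : ∀ p (i : Fin d),
      pt (fun q => αp0 q * ρp0 q * up0 q i) p
      + divT (fun q => αp0 q * ρp0 q) up0 p i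
      + αp0 p * pd i (fun q =>
          ρp0 q ^ γp * Real.exp (Sp0 q) * (γp * ρp1 q / ρp0 q + Sp1 q)) p
      + αp1 p * pd i (fun q => ρp0 q ^ γp * Real.exp (Sp0 q)) p
      + pint0 p * pd i αp0 p = 0)
    (hmomm : ∀ p (i : Fin d),
      pt (fun q => αm0 q * ρm0 q * um0 q i) p
      + divT (fun q => αm0 q * ρm0 q) um0 p i
      + αm0 p * pd i (fun q =>
          ρm0 q ^ γm * Real.exp (Sm0 q) * (γm * ρm1 q / ρm0 q + Sm1 q)) p
      + αm1 p * pd i (fun q => ρm0 q ^ γm * Real.exp (Sm0 q)) p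
      + pint0 p * pd i αm0 p = 0) :
    -- conclusions
    (∃ C : ℝ, 0 < C ∧
      (∀ p : Pt d, ρp0 p ^ γp * Real.exp (Sp0 p) = C) ∧
      (∀ p : Pt d, ρm0 p ^ γm * Real.exp (Sm0 p) = C) ∧
      (∀ p : Pt d, ρp0 p = C ^ (1 / γp) * Real.exp (-Sp0 p / γp)) ∧
      (∀ p : Pt d, ρm0 p = C ^ (1 / γm) * Real.exp (-Sm0 p / γm))) ∧
    (∀ p : Pt d, divg (fun q j => αp0 q * up0 q j + αm0 q * um0 q j) p = 0) ∧
    (∀ p : Pt d, pt αp0 p + divg (fun q j => αp0 q * up0 q j) p = 0) ∧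
    (∀ p : Pt d, pt αm0 p + divg (fun q j => αm0 q * um0 q j) p = 0) ∧
    (∀ p (i : Fin d),
      pt (fun q => αp0 q * ρp0 q * up0 q i) p
      + divT (fun q => αp0 q * ρp0 q) up0 p i
      + αp0 p * pd i (fun q =>
          ρp0 q ^ γp * Real.exp (Sp0 q) * (γp * ρp1 q / ρp0 q + Sp1 q)) p
      + pint0 p * pd i αp0 p = 0) ∧
    (∀ p (i : Fin d),
      pt (fun q => αm0 q * ρm0 q * um0 q i) p
      + divT (fun q => αm0 q * ρm0 q) um0 p i
      + αm0 p * pd i (fun q =>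
          ρp0 q ^ γp * Real.exp (Sp0 q) * (γp * ρp1 q / ρp0 q + Sp1 q)) p
      + pint0 p * pd i αm0 p = 0) := by
  obtain ⟨n, rfl⟩ : ∃ n, d = n + 1 := ⟨d - 1, by omega⟩
  obtain ⟨cαp, cαm, -, -, cρp, cρm, -, -, cSp, cSm, -, -, -, cup, cum⟩ := hreg
  obtain ⟨pαp, pαm, -, -, -, -, -, -, -, -, -, -, -, pup, pum⟩ := hper
  have hαm : ∀ p, 0 < αm0 p := fun p => by linarith [hα0 p, (hαpos p).2]
  have dαp := cαp.differentiable (by simp)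
  have dαm := cαm.differentiable (by simp)
  have dρp := cρp.differentiable (by simp)
  have dρm := cρm.differentiable (by simp)
  have dSp := cSp.differentiable (by simp)
  have dSm := cSm.differentiable (by simp)
  have cupi := contDiff_pi.1 cup
  have cumi := contDiff_pi.1 cum
  have dup : ∀ i, Differentiable ℝ fun q => up0 q i := fun i => (cupi i).differentiable (by simp)
  have dum : ∀ i, Differentiable ℝ fun q => um0 q i := fun i => (cumi i).differentiable (by simp)
  have gp : ∀ p i, pd i (fun q => ρp0 q ^ γp * exp (Sp0 q)) p = 0 := fun p i =>
    (mul_eq_zero.1 (hgradp p i)).resolve_left (hαpos p).1.ne'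
  have gm : ∀ p i, pd i (fun q => ρm0 q ^ γm * exp (Sm0 q)) p = 0 := fun p i =>
    (mul_eq_zero.1 (hgradm p i)).resolve_left (hαm p).ne'
  have Tp := fun p => pt_add_divg_volumeFraction dαp dρp dSp dup (hρp p) (gp p) (hmassp p)
    (hentp p)
  have Tm := fun p => pt_add_divg_volumeFraction dαm dρm dSm dum (hρm p) (gm p) (hmassm p)
    (hentm p)
  rw [← funext hpeq0] at Tm
  simp_rw [← hpeq0] at Tm
  set P : Pt (n + 1) → ℝ := fun q => ρp0 q ^ γp * exp (Sp0 q) with hP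
  have hPpos : ∀ p, 0 < P p := fun p => mul_pos (rpow_pos_of_pos (hρp p) _) (exp_pos _)
  have dP : Differentiable ℝ P :=
    (dρp.rpow_const fun p => Or.inl (hρp p).ne').mul dSp.exp
  have hsum : ∀ p, pt αp0 p + pt αm0 p = 0 := fun p => by
    have h : (fun q => αp0 q + αm0 q) = fun _ => (1 : ℝ) := funext hα0
    have h' := fderiv_fun_add (dαp p) (dαm p)
    rw [h, fderiv_fun_const] at h'
    exact (DFunLike.congr_fun h' (1, 0)).symm
  have hdiv : ∀ p, divg (fun q j => αp0 q * up0 q j + αm0 q * um0 q j) p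
      = divg (fun q j => αp0 q * up0 q j) p + divg (fun q j => αm0 q * um0 q j) p := fun p =>
    divg_add (fun i => (dαp p).mul (dup i p)) (fun i => (dαm p).mul (dum i p))
  have hPt : ∀ p, pt P p = 0 := by
    rintro ⟨t, x₀⟩
    refine eq_zero_of_divg_eq_neg_mul (F := fun q j => αp0 q * up0 q j + αm0 q * um0 q j)
      (w := fun x => (αp0 (t, x) / γp + αm0 (t, x) / γm) / P (t, x)) (t := t) ?_ ?_ _ ?_ ?_ ?_
    · exact fun i => ((cαp.mul (cupi i)).add (cαm.mul (cumi i))).of_le (by simp)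
    · intro i k t x
      have h1 := pαp k t x
      have h2 := pαm k t x
      have h3 := pup i k t x
      have h4 := pum i k t x
      simp only at h3 h4 ⊢
      rw [h1, h2, h3, h4]
    · have := cαp.continuous
      have := cαm.continuous
      have := dP.continuous
      exact Continuous.div₀ (by fun_prop) (by fun_prop) fun x => (hPpos _).ne'
    · intro x
      have := (hαpos (t, x)).1
      have := hαm (t, x)
      have := hPpos (t, x)
      positivity
    · intro x
      have hp := Tp (t, x)
      have hm := Tm (t, x)
      have hs := hsum (t, x)
      have hPx := hPpos (t, x)
      rw [pt_eq_of_pd_eq_zero dP gp t x₀ x, hdiv]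
      have ep : pt αp0 (t, x) + divg (fun q j => αp0 q * up0 q j) (t, x)
          = -αp0 (t, x) * pt P (t, x) / (γp * P (t, x)) := by
        rw [eq_div_iff (by positivity), ← hp]
        ring
      have em : pt αm0 (t, x) + divg (fun q j => αm0 q * um0 q j) (t, x)
          = -αm0 (t, x) * pt P (t, x) / (γm * P (t, x)) := by
        rw [eq_div_iff (by positivity), ← hm]
        ring
      have e : -pt P (t, x) * ((αp0 (t, x) / γp + αm0 (t, x) / γm) / P (t, x))
          = -αp0 (t, x) * pt P (t, x) / (γp * P (t, x))
            + -αm0 (t, x) * pt P (t, x) / (γm * P (t, x)) := by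
        field_simp
        ring
      linarith
  have hC : ∀ p, P p = P 0 := fun p => eq_of_pt_pd_eq_zero dP hPt gp p 0
  have vp : ∀ p, pt αp0 p + divg (fun q j => αp0 q * up0 q j) p = 0 := fun p => by
    have h := Tp p
    rw [hPt, mul_zero] at h
    exact (mul_eq_zero.1 h).resolve_left (mul_pos (by linarith) (hPpos p)).ne'
  have vm : ∀ p, pt αm0 p + divg (fun q j => αm0 q * um0 q j) p = 0 := fun p => by
    have h := Tm p
    rw [hPt, mul_zero] at h
    exact (mul_eq_zero.1 h).resolve_left (mul_pos (by linarith) (hPpos p)).ne'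
  have hCm : ∀ p, ρm0 p ^ γm * exp (Sm0 p) = P 0 := fun p => (hpeq0 p).symm.trans (hC p)
  refine ⟨⟨P 0, hPpos 0, hC, hCm,
    fun p => eq_rpow_mul_exp_of_pressure_eq (by linarith) (hρp p) (hC p),
    fun p => eq_rpow_mul_exp_of_pressure_eq (by linarith) (hρm p) (hCm p)⟩,
    fun p => ?_, vp, vm, fun p i => ?_, fun p i => ?_⟩
  · rw [hdiv]
    linarith [hsum p, vp p, vm p]
  · have h := hmomp p i
    rwa [gp p i, mul_zero, add_zero] at h
  · have h := hmomm p i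
    rw [gm p i, mul_zero, add_zero, ← funext hpeq1] at h
    exact h
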